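/- arXiv:2212.01466 — 2 statements merged into one kernel-verified Lean document; each statement's English description precedes it below -/
import Mathlib

section
/- Let g be an indecomposable finite-dimensional Lie algebra over a field of characteristic zero whose solvable radical n is nilpotent of nilindex t+1, and suppose g has a nontrivial Levi decomposition g = s ⊕ n with s a semisimple subalgebra. Then n decomposes into a direct sum of s-modules n = m₁ ⊕ m₂ ⊕ ... ⊕ m_t such that n^j = m_j ⊕ n^{j+1} for each j, m_j ⊆ [m₁, m_{j−1}] for 2 ≤ j ≤ t, m₁ is a faithful s-module, and for 2 ≤ j ≤ t each m_j is a direct sum of some subset of the irreducible components of the tensor-product s-module m₁ ⊗ m_{j−1}. -/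
/-- `idealPow n j` is the `j`-th term `n^j` of the lower central series of the ideal `n`
(computed inside the ambient Lie algebra): `n¹ = n`, `n^{j+1} = ⁅n, n^j⁆`.
By convention `idealPow n 0 = ⊤`. -/
def idealPow {K : Type*} [CommRing K] {g : Type*} [LieRing g] [LieAlgebra K g]
    (n : LieIdeal K g) : ℕ → LieIdeal K g
  | 0 => ⊤
  | 1 => n
  | (j + 2) => ⁅n, idealPow n (j + 1)⁆

theorem LieIdeal.lie_self_eq_self {K L : Type*} [Field K] [LieRing L] [LieAlgebra K L]
    [FiniteDimensional K L] [LieAlgebra.IsKilling K L] (I : LieIdeal K L) : ⁅I, I⁆ = I := by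
  set D : LieIdeal K L := ⁅I, I⁆
  have hDI : D ≤ I := LieSubmodule.lie_le_left I I
  have hab : I ⊓ D.killingCompl ≤ ⊥ := by
    have hI := (LieIdeal.isCompl_killingCompl I).inf_eq_bot
    have key : ⁅I ⊓ D.killingCompl, I⁆ = ⊥ := by
      rw [LieSubmodule.lie_eq_bot_iff]
      intro x hx y hy
      have : ⁅x, y⁆ ∈ I ⊓ I.killingCompl := by
        refine ⟨lie_mem_right K L I x y hy, ?_⟩
        refine (LieIdeal.mem_killingCompl K L I).mpr fun z hz => ?_
        rw [LieModule.traceForm_comm, LieModule.traceForm_apply_lie_apply,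
          LieModule.traceForm_comm]
        exact (LieIdeal.mem_killingCompl K L D).mp hx.2 _ (LieSubmodule.lie_mem_lie hy hz)
      simpa [hI] using this
    have : IsLieAbelian (I ⊓ D.killingCompl : LieIdeal K L) := by
      rw [LieSubmodule.lie_abelian_iff_lie_self_eq_bot, eq_bot_iff, ← key]
      exact LieSubmodule.mono_lie_right _ inf_le_left
    exact (LieAlgebra.IsKilling.ideal_eq_bot_of_isLieAbelian _).le
  refine le_antisymm hDI fun x hx => ?_
  have hx' : x ∈ D ⊔ D.killingCompl := by
    rw [(LieIdeal.isCompl_killingCompl D).sup_eq_top]; trivial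
  obtain ⟨y, hy, z, hz, rfl⟩ := (LieSubmodule.mem_sup _ _ _).mp hx'
  have : z ∈ I ⊓ D.killingCompl := ⟨by simpa using sub_mem hx (hDI hy), hz⟩
  have hz0 : z = 0 := by simpa using hab this
  simpa [hz0] using hy

namespace LieModule

variable {K L V : Type*} [Field K] [LieRing L] [LieAlgebra K L]
  [AddCommGroup V] [Module K V] [LieRingModule L V] [LieModule K L V]

/-- A cocycle on a Lie algebra is zero on any perfect ideal that acts trivially. -/
theorem cocycle_eq_zero_of_mem_ideal {K L V : Type*} [Field K] [LieRing L] [LieAlgebra K L]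
    [AddCommGroup V] [Module K V] [LieRingModule L V] {I : LieIdeal K L} (hI : ⁅I, I⁆ = I)
    (htriv : ∀ x ∈ I, ∀ v : V, ⁅x, v⁆ = 0) {c : L →ₗ[K] V}
    (hc : ∀ x y, c ⁅x, y⁆ = ⁅x, c y⁆ - ⁅y, c x⁆) {x : L} (hx : x ∈ I) : c x = 0 := by
  rw [← hI, ← LieSubmodule.mem_toSubmodule, LieSubmodule.lieIdeal_oper_eq_linear_span'] at hx
  induction hx using Submodule.span_induction with
  | mem _ h =>
    obtain ⟨a, ha, b, hb, rfl⟩ := h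
    simp [hc, htriv _ ha, htriv _ hb]
  | zero => simp
  | add _ _ _ _ h₁ h₂ => simp [h₁, h₂]
  | smul _ _ _ h => simp [h]

/-- The kernel of the trace form, as a Lie ideal. -/
noncomputable def traceFormKer (K L V : Type*) [Field K] [LieRing L] [LieAlgebra K L]
    [AddCommGroup V] [Module K V] [LieRingModule L V] [LieModule K L V] : LieIdeal K L where
  __ := LinearMap.ker (traceForm K L V)
  lie_mem {x y} hy := by
    change traceForm K L V ⁅x, y⁆ = 0
    replace hy : traceForm K L V y = 0 := hy
    ext z
    rw [traceForm_apply_lie_apply', hy]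
    simp

theorem mem_traceFormKer {x : L} : x ∈ traceFormKer K L V ↔ traceForm K L V x = 0 := Iff.rfl

theorem lie_eq_zero_of_mem_traceFormKer [CharZero K] [FiniteDimensional K L]
    [LieAlgebra.IsKilling K L] [FiniteDimensional K V] [IsIrreducible K L V]
    {x : L} (hx : x ∈ traceFormKer K L V) (v : V) : ⁅x, v⁆ = 0 := by
  set I := traceFormKer K L V
  have : Nontrivial V := nontrivial_of_isIrreducible K L V
  have htf : traceForm K I V = 0 := by
    ext ⟨a, ha⟩ b
    change traceForm K L V a b = 0
    rw [mem_traceFormKer.mp ha]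
    rfl
  have := isNilpotent_derivedSeries_of_traceForm_eq_zero htf
  have := nontrivial_max_triv_of_isNilpotent K (LieAlgebra.derivedSeries K I 1) V
  obtain ⟨⟨w, hw⟩, hw0⟩ := exists_ne (0 : maxTrivSubmodule K (LieAlgebra.derivedSeries K I 1) V)
  let W : LieSubmodule K L V :=
    { carrier := {u | ∀ a ∈ I, ⁅a, u⁆ = 0}
      zero_mem' := by simp
      add_mem' := fun {u u'} hu hu' a ha => by rw [lie_add, hu a ha, hu' a ha, add_zero]
      smul_mem' := fun r u hu a ha => by rw [lie_smul, hu a ha, smul_zero]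
      lie_mem := fun {y u} hu a ha => by
        rw [leibniz_lie, hu a ha, hu _ (lie_mem_left K L I a y ha), lie_zero, add_zero] }
  have hwW : w ∈ W := by
    intro a ha
    rw [← LieIdeal.lie_self_eq_self I, ← LieSubmodule.mem_toSubmodule,
      LieSubmodule.lieIdeal_oper_eq_linear_span'] at ha
    induction ha using Submodule.span_induction with
    | mem _ h =>
      obtain ⟨a, ha, b, hb, rfl⟩ := h
      refine hw ⟨⁅(⟨a, ha⟩ : I), (⟨b, hb⟩ : I)⁆, ?_⟩
      exact LieSubmodule.lie_mem_lie trivial trivial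
    | zero => simp
    | add _ _ _ _ h₁ h₂ => simp [h₁, h₂]
    | smul _ _ _ h => simp [h]
  have hW : W = ⊤ := (eq_bot_or_eq_top W).resolve_left fun h => hw0 <| by
    rw [h] at hwW
    simpa using hwW
  have : v ∈ W := hW ▸ LieSubmodule.mem_top v
  exact this x hx

/-- First Whitehead lemma, irreducible case. -/
theorem exists_eq_lie_of_cocycle_of_isIrreducible [CharZero K] [FiniteDimensional K L]
    [LieAlgebra.IsKilling K L] [FiniteDimensional K V] [IsIrreducible K L V] {c : L →ₗ[K] V}
    (hc : ∀ x y, c ⁅x, y⁆ = ⁅x, c y⁆ - ⁅y, c x⁆) : ∃ v, ∀ x, c x = ⁅x, v⁆ := by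
  set I := traceFormKer K L V
  set B := traceForm K L V with hB
  have hIV : ∀ x ∈ I, ∀ v : V, ⁅x, v⁆ = 0 := fun x hx => lie_eq_zero_of_mem_traceFormKer hx
  have hIc : ∀ x ∈ I, c x = 0 := fun x hx =>
    cocycle_eq_zero_of_mem_ideal (LieIdeal.lie_self_eq_self I) hIV hc hx
  have hBI : ∀ x ∈ I, ∀ y, B x y = 0 := fun x hx y => by
    rw [mem_traceFormKer.mp hx, LinearMap.zero_apply]
  by_cases hItop : I = ⊤
  · exact ⟨0, fun x => by rw [hIc x (hItop ▸ LieSubmodule.mem_top x), lie_zero]⟩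
  obtain ⟨J, hJ⟩ := Submodule.exists_isCompl I.toSubmodule
  have hdec : ∀ x : L, ∃ z ∈ I, ∃ y : J, x = z + y := fun x => by
    obtain ⟨z, hz, y, hy, rfl⟩ := Submodule.mem_sup.mp
      (hJ.sup_eq_top ▸ Submodule.mem_top : x ∈ I.toSubmodule ⊔ J)
    exact ⟨z, hz, ⟨y, hy⟩, rfl⟩
  have hsymm : (B.restrict J).IsSymm := ⟨fun x y => traceForm_comm K L V x y⟩
  have hnd : (B.restrict J).Nondegenerate :=
    (traceForm_isSymm K L V).nondegenerate_restrict_of_isCompl_ker hJ.symm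
  let e := Module.finBasis K J
  let f := (B.restrict J).dualBasis hnd e
  have he : (B.restrict J).dualBasis hnd f = e :=
    LinearMap.BilinForm.dualBasis_dualBasis hnd hsymm e
  have expand_f (g : L →ₗ[K] V)
      (hg : ∀ x ∈ I, g x = 0) (x : L) : g x = ∑ i, B x (e i) • g (f i) := by
    obtain ⟨z, hz, y, rfl⟩ := hdec x
    have := congrArg (g ∘ J.subtype) (f.sum_repr y)
    simp only [f, LinearMap.BilinForm.dualBasis_repr_apply] at this
    simp only [map_add, hg z hz, LinearMap.add_apply, hBI z hz, zero_add]
    simpa [f] using this.symm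
  have expand_e (g : L →ₗ[K] V)
      (hg : ∀ x ∈ I, g x = 0) (x : L) : g x = ∑ i, B x (f i) • g (e i) := by
    obtain ⟨z, hz, y, rfl⟩ := hdec x
    have hrepr (i) : e.repr y i = B y (f i) := by
      have := LinearMap.BilinForm.dualBasis_repr_apply hnd f y i
      rwa [he] at this
    have := congrArg (g ∘ J.subtype) (e.sum_repr y)
    simp only [hrepr] at this
    simp only [map_add, hg z hz, LinearMap.add_apply, hBI z hz, zero_add]
    simpa using this.symm
  let act (v : V) : L →ₗ[K] V :=
    { toFun := fun x => ⁅x, v⁆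
      map_add' := fun x y => add_lie x y v
      map_smul' := fun r x => smul_lie r x v }
  have invariance (g : L →ₗ[K] V) (hg : ∀ x ∈ I, g x = 0) (x : L) :
      ∑ i, (⁅⁅x, (e i : L)⁆, g (f i)⁆ + ⁅(e i : L), g ⁅x, (f i : L)⁆⁆) = 0 := by
    have h₁ (i) : ⁅⁅x, (e i : L)⁆, g (f i)⁆ =
        ∑ j, B ⁅x, (e i : L)⁆ (f j) • ⁅(e j : L), g (f i)⁆ :=
      expand_e (act (g (f i))) (fun y hy => hIV y hy _) _
    have h₂ (i) : ⁅(e i : L), g ⁅x, (f i : L)⁆⁆ =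
        -∑ j, B ⁅x, (e j : L)⁆ (f i) • ⁅(e i : L), g (f j)⁆ := by
      rw [expand_f g hg, lie_sum, ← Finset.sum_neg_distrib]
      refine Finset.sum_congr rfl fun j _ => ?_
      rw [lie_smul, hB, traceForm_apply_lie_apply', traceForm_comm, neg_smul]
    simp only [h₁, h₂, Finset.sum_add_distrib, Finset.sum_neg_distrib]
    rw [Finset.sum_comm, add_neg_cancel]
  let Ω : V →ₗ⁅K, L⁆ V :=
    { (∑ i, toEnd K L V (e i) ∘ₗ toEnd K L V (f i) : Module.End K V) with
      map_lie' := fun {x v} => by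
        have := invariance (act v) (fun y hy => hIV y hy _) x
        simp only [act, LinearMap.coe_mk, AddHom.coe_mk] at this
        simp only [AddHom.toFun_eq_coe, LinearMap.coe_toAddHom, LinearMap.sum_apply,
          LinearMap.comp_apply, toEnd_apply_apply, lie_sum]
        rw [← sub_eq_zero, ← Finset.sum_sub_distrib, ← neg_eq_zero, ← Finset.sum_neg_distrib,
          ← this]
        refine Finset.sum_congr rfl fun i _ => ?_
        rw [leibniz_lie x (e i : L), leibniz_lie x (f i : L), lie_add]
        abel }
  have hΩ (v : V) : Ω v = ∑ i, ⁅(e i : L), ⁅(f i : L), v⁆⁆ := by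
    change (∑ i, toEnd K L V (e i) ∘ₗ toEnd K L V (f i) : Module.End K V) v = _
    simp
  have htrace : LinearMap.trace K V (Ω : V →ₗ[K] V) = Module.finrank K J := by
    change LinearMap.trace K V (∑ i, toEnd K L V (e i) ∘ₗ toEnd K L V (f i)) = _
    have (i : Fin (Module.finrank K J)) :
        LinearMap.trace K V (toEnd K L V (e i) ∘ₗ toEnd K L V (f i)) = 1 := by
      have := LinearMap.BilinForm.apply_dualBasis_right hnd hsymm e i i
      rw [if_pos rfl] at this
      exact this
    simp [this]
  have hJ0 : Module.finrank K J ≠ 0 := fun h => hItop <| by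
    rw [Submodule.finrank_eq_zero.mp h] at hJ
    simpa using hJ.sup_eq_top
  have hinj : Function.Injective Ω := by
    rw [← LieModuleHom.ker_eq_bot]
    refine (eq_bot_or_eq_top Ω.ker).resolve_right fun h => hJ0 ?_
    have : (Ω : V →ₗ[K] V) = 0 := by
      ext v
      exact (LieModuleHom.mem_ker (f := Ω)).mp (h ▸ LieSubmodule.mem_top v)
    rw [this, map_zero] at htrace
    exact_mod_cast htrace.symm
  obtain ⟨v, hv⟩ := LinearMap.surjective_of_injective (f := (Ω : V →ₗ[K] V)) hinj
    (∑ i, ⁅(e i : L), c (f i)⁆)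
  refine ⟨v, fun x => hinj ?_⟩
  rw [LieModuleHom.map_lie, show Ω v = _ from hv, hΩ, lie_sum, ← sub_eq_zero,
    ← Finset.sum_sub_distrib, ← neg_eq_zero, ← Finset.sum_neg_distrib, ← invariance c hIc x]
  refine Finset.sum_congr rfl fun i _ => ?_
  rw [leibniz_lie x (e i : L), hc x, lie_sub]
  abel

/-- First Whitehead lemma: every `V`-valued cocycle on a semisimple Lie algebra is a coboundary. -/
theorem exists_eq_lie_of_cocycle {K L V : Type*} [Field K] [CharZero K] [LieRing L]
    [LieAlgebra K L] [FiniteDimensional K L] [LieAlgebra.IsKilling K L] [AddCommGroup V]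
    [Module K V] [LieRingModule L V] [LieModule K L V] [FiniteDimensional K V] {c : L →ₗ[K] V}
    (hc : ∀ x y, c ⁅x, y⁆ = ⁅x, c y⁆ - ⁅y, c x⁆) : ∃ v, ∀ x, c x = ⁅x, v⁆ := by
  induction hn : Module.finrank K V using Nat.strong_induction_on generalizing V with
  | _ n ih =>
  subst hn
  rcases subsingleton_or_nontrivial V with _ | _
  · exact ⟨0, fun x => Subsingleton.elim _ _⟩
  by_cases hirr : ∀ W : LieSubmodule K L V, W ≠ ⊥ → W = ⊤
  · have : IsIrreducible K L V := IsIrreducible.mk hirr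
    exact exists_eq_lie_of_cocycle_of_isIrreducible hc
  push Not at hirr
  obtain ⟨W, hbot, htop⟩ := hirr
  have hlt : Module.finrank K W < Module.finrank K V :=
    Submodule.finrank_lt (by simpa using htop)
  have hpos : 0 < Module.finrank K W := by
    have : Nontrivial W := (LieSubmodule.nontrivial_iff_ne_bot K L V).mpr hbot
    exact Module.finrank_pos
  have hquot := W.toSubmodule.finrank_quotient_add_finrank
  obtain ⟨v', hv'⟩ := ih (Module.finrank K (V ⧸ W))
    (by change Module.finrank K (V ⧸ W.toSubmodule) < _
        change _ + Module.finrank K W = _ at hquot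
        omega)
    (V := V ⧸ W) (c := (LieSubmodule.Quotient.mk' W : V →ₗ[K] V ⧸ W) ∘ₗ c)
    (fun x y => by
      simp only [LinearMap.comp_apply, hc, map_sub]
      simp [LieModuleHom.map_lie]) rfl
  obtain ⟨v, rfl⟩ := LieSubmodule.Quotient.surjective_mk' W v'
  have hmem (x : L) : c x - ⁅x, v⁆ ∈ W := by
    rw [← LieSubmodule.Quotient.mk_eq_zero, map_sub, LieModuleHom.map_lie]
    exact sub_eq_zero.mpr (hv' x)
  obtain ⟨w, hw⟩ := ih _ hlt (V := W)
    (c := { toFun := fun x => ⟨c x - ⁅x, v⁆, hmem x⟩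
            map_add' := fun x y => by
              ext; simp only [map_add, add_lie, LieSubmodule.coe_add]; abel
            map_smul' := fun r x => by
              ext; simp [smul_sub] })
    (fun x y => by
      ext
      simp only [LinearMap.coe_mk, AddHom.coe_mk, LieSubmodule.coe_sub, LieSubmodule.coe_bracket,
        hc, lie_sub, lie_lie]
      abel) rfl
  refine ⟨v + w, fun x => ?_⟩
  have := congrArg (Subtype.val) (hw x)
  simp only [LinearMap.coe_mk, AddHom.coe_mk, LieSubmodule.coe_bracket] at this
  rw [lie_add, ← this]
  abel

/-- Weyl's theorem: submodules of finite-dimensional modules over a semisimple Lie algebra admit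
equivariant projections. -/
theorem exists_projection {K L M : Type*} [Field K] [CharZero K] [LieRing L]
    [LieAlgebra K L] [FiniteDimensional K L] [LieAlgebra.IsKilling K L] [AddCommGroup M]
    [Module K M] [LieRingModule L M] [LieModule K L M] [FiniteDimensional K M]
    (N : LieSubmodule K L M) : ∃ p : M →ₗ⁅K, L⁆ N, ∀ n : N, p n = n := by
  let V : LieSubmodule K L (M →ₗ[K] N) :=
    { carrier := {f | ∀ n : N, f n = 0}
      zero_mem' := by simp
      add_mem' := fun {f f'} hf hf' n => by simp [hf n, hf' n]
      smul_mem' := fun r f hf n => by simp [hf n]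
      lie_mem := fun {x f} hf n => by
        rw [LieHom.lie_apply, hf n, ← LieSubmodule.coe_bracket, hf, lie_zero, sub_zero] }
  obtain ⟨p, hp⟩ : ∃ p : M →ₗ[K] N, ∀ n : N, p n = n := by
    obtain ⟨p, hp⟩ := N.toSubmodule.subtype.exists_leftInverse_of_injective
      (LinearMap.ker_eq_bot.mpr Subtype.val_injective)
    exact ⟨p, LinearMap.congr_fun hp⟩
  have hmem (x : L) : ⁅x, p⁆ ∈ V := fun n => by
    rw [LieHom.lie_apply, hp, ← LieSubmodule.coe_bracket, hp, sub_self]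
  obtain ⟨φ, hφ⟩ := exists_eq_lie_of_cocycle (V := V)
    (c := { toFun := fun x => ⟨⁅x, p⁆, hmem x⟩
            map_add' := fun x y => Subtype.ext (add_lie x y p)
            map_smul' := fun (r : K) x => Subtype.ext (smul_lie r x p) })
    (fun x y => by
      apply Subtype.ext
      exact lie_lie x y p)
  refine ⟨{ (p - (φ : M →ₗ[K] N)) with map_lie' := fun {x m} => ?_ }, fun n => ?_⟩
  · have := LinearMap.congr_fun (congrArg Subtype.val (hφ x)) m
    change ⁅x, p⁆ m = ⁅x, (φ : M →ₗ[K] N)⁆ m at this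
    rw [LieHom.lie_apply, LieHom.lie_apply] at this
    change p ⁅x, m⁆ - φ.1 ⁅x, m⁆ = ⁅x, p m - φ.1 m⁆
    rw [lie_sub, ← sub_eq_zero, ← sub_eq_zero.mpr this.symm]
    abel
  · change p n - φ.1 n = n
    rw [hp, φ.2 n, sub_zero]

/-- Weyl's theorem: complements of intersections. -/
theorem exists_le_sup_eq_inf_eq_bot {K L M : Type*} [Field K] [CharZero K] [LieRing L]
    [LieAlgebra K L] [FiniteDimensional K L] [LieAlgebra.IsKilling K L] [AddCommGroup M]
    [Module K M] [LieRingModule L M] [LieModule K L M] [FiniteDimensional K M]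
    (W A : LieSubmodule K L M) : ∃ C ≤ W, C ⊔ W ⊓ A = W ∧ C ⊓ A = ⊥ := by
  obtain ⟨p, hp⟩ := exists_projection (W ⊓ A)
  refine ⟨W ⊓ p.ker, inf_le_left, le_antisymm (sup_le inf_le_left inf_le_left) fun x hx => ?_, ?_⟩
  · refine (LieSubmodule.mem_sup _ _ _).mpr ⟨x - p x, ⟨sub_mem hx (p x).2.1, ?_⟩, p x, (p x).2, ?_⟩
    · exact LieModuleHom.mem_ker.mpr (by rw [map_sub, hp, sub_self])
    · abel
  · rw [eq_bot_iff]
    rintro x ⟨⟨hW, hx⟩, hA⟩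
    have := hp ⟨x, hW, hA⟩
    rw [LieModuleHom.mem_ker.mp hx] at this
    exact congrArg Subtype.val this.symm

end LieModule

section

variable {K g : Type*} [Field K] [LieRing g] [LieAlgebra K g]

theorem idealPow_succ_le (n : LieIdeal K g) (k : ℕ) :
    idealPow n (k + 2) ≤ idealPow n (k + 1) := LieSubmodule.lie_le_right _ _

theorem idealPow_succ_le_self (n : LieIdeal K g) (k : ℕ) : idealPow n (k + 1) ≤ n := by
  induction k with
  | zero => exact le_rfl
  | succ k ih => exact (idealPow_succ_le n k).trans ih

theorem lie_mem_idealPow {n : LieIdeal K g} {k : ℕ} {x y : g} (hx : x ∈ n)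
    (hy : y ∈ idealPow n (k + 1)) : ⁅x, y⁆ ∈ idealPow n (k + 2) :=
  LieSubmodule.lie_mem_lie hx hy

theorem lie_mem_idealPow_of_mem_idealPow_two {n : LieIdeal K g} {k : ℕ} {x y : g}
    (hx : x ∈ idealPow n 2) (hy : y ∈ idealPow n (k + 1)) : ⁅x, y⁆ ∈ idealPow n (k + 3) := by
  change x ∈ ⁅n, n⁆ at hx
  rw [← LieSubmodule.mem_toSubmodule, LieSubmodule.lieIdeal_oper_eq_linear_span'] at hx
  induction hx using Submodule.span_induction with
  | mem _ h =>
    obtain ⟨a, ha, b, hb, rfl⟩ := h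
    rw [lie_lie]
    exact sub_mem (lie_mem_idealPow ha (lie_mem_idealPow hb hy))
      (lie_mem_idealPow hb (lie_mem_idealPow ha hy))
  | zero => simp
  | add _ _ _ _ h₁ h₂ => rw [add_lie]; exact add_mem h₁ h₂
  | smul r _ _ h => rw [smul_lie]; exact (idealPow n (k + 3)).smul_mem r h

namespace LieSubalgebra

variable (s : LieSubalgebra K g)

/-- A Lie ideal, viewed as a module over a Lie subalgebra. -/
def ofIdeal (I : LieIdeal K g) : LieSubmodule K s g where
  __ := I.toSubmodule
  lie_mem {x y} hy := lie_mem_right K g I x y hy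

variable {s}

theorem mem_ofIdeal {I : LieIdeal K g} {x : g} : x ∈ s.ofIdeal I ↔ x ∈ I := Iff.rfl

@[simp]
theorem ofIdeal_toSubmodule (I : LieIdeal K g) : (s.ofIdeal I).toSubmodule = I.toSubmodule := rfl

/-- The span of the brackets of two modules over a Lie subalgebra. -/
def bracketSpan (A B : LieSubmodule K s g) : LieSubmodule K s g where
  __ := Submodule.span K {z : g | ∃ u ∈ A, ∃ v ∈ B, z = ⁅u, v⁆}
  lie_mem {x y} hy := by
    change ⁅(x : g), y⁆ ∈ Submodule.span K {z : g | ∃ u ∈ A, ∃ v ∈ B, z = ⁅u, v⁆}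
    replace hy : y ∈ Submodule.span K {z : g | ∃ u ∈ A, ∃ v ∈ B, z = ⁅u, v⁆} := hy
    induction hy using Submodule.span_induction with
    | mem _ h =>
      obtain ⟨a, ha, b, hb, rfl⟩ := h
      rw [leibniz_lie]
      exact add_mem (Submodule.subset_span ⟨_, A.lie_mem (x := x) ha, _, hb, rfl⟩)
        (Submodule.subset_span ⟨_, ha, _, B.lie_mem (x := x) hb, rfl⟩)
    | zero => simp
    | add _ _ _ _ h₁ h₂ => rw [lie_add]; exact add_mem h₁ h₂
    | smul r _ _ h => rw [lie_smul]; exact Submodule.smul_mem _ r h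

theorem lie_mem_bracketSpan {A B : LieSubmodule K s g} {u v : g} (hu : u ∈ A) (hv : v ∈ B) :
    ⁅u, v⁆ ∈ bracketSpan A B := Submodule.subset_span ⟨u, hu, v, hv, rfl⟩

theorem bracketSpan_le {A B C : LieSubmodule K s g} :
    bracketSpan A B ≤ C ↔ ∀ u ∈ A, ∀ v ∈ B, ⁅u, v⁆ ∈ C := by
  refine ⟨fun h u hu v hv => h (lie_mem_bracketSpan hu hv), fun h => ?_⟩
  refine Submodule.span_le (p := C.toSubmodule).mpr ?_
  rintro _ ⟨u, hu, v, hv, rfl⟩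
  exact h u hu v hv

/-- If `n = A ⊕ n²` and `n^j = B + n^{j+1}`, then `n^{j+1} = [A, B] + n^{j+2}`. -/
theorem bracketSpan_sup_eq {n : LieIdeal K g} {A B : LieSubmodule K s g} {k : ℕ}
    (hA : A ⊔ s.ofIdeal (idealPow n 2) = s.ofIdeal n)
    (hB : B ⊔ s.ofIdeal (idealPow n (k + 2)) = s.ofIdeal (idealPow n (k + 1))) :
    bracketSpan A B ⊔ s.ofIdeal (idealPow n (k + 3)) = s.ofIdeal (idealPow n (k + 2)) := by
  have hBmem (v) (hv : v ∈ B) : v ∈ idealPow n (k + 1) :=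
    mem_ofIdeal.mp (hB ▸ le_sup_left (a := B) hv)
  refine le_antisymm (sup_le (bracketSpan_le.mpr fun u hu v hv => ?_)
    (idealPow_succ_le n (k + 1))) ?_
  · exact lie_mem_idealPow (mem_ofIdeal.mp (hA ▸ le_sup_left (a := A) hu)) (hBmem v hv)
  intro z hz
  replace hz : z ∈ ⁅n, idealPow n (k + 1)⁆ := hz
  rw [← LieSubmodule.mem_toSubmodule, LieSubmodule.lieIdeal_oper_eq_linear_span'] at hz
  refine Submodule.span_le (p := LieSubmodule.toSubmodule _).mpr ?_ hz
  rintro _ ⟨x, hx, y, hy, rfl⟩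
  obtain ⟨a, ha, b, hb, rfl⟩ := (LieSubmodule.mem_sup _ _ _).mp (hA.ge hx)
  obtain ⟨u, hu, v, hv, rfl⟩ := (LieSubmodule.mem_sup _ _ _).mp (hB.ge hy)
  refine (LieSubmodule.mem_sup _ _ _).mpr
    ⟨⁅a, u⁆, lie_mem_bracketSpan ha hu, ⁅a, v⁆ + ⁅b, u + v⁆, add_mem ?_ ?_, ?_⟩
  · exact lie_mem_idealPow (k := k + 1) (mem_ofIdeal.mp (hA ▸ le_sup_left (a := A) ha)) hv
  · exact lie_mem_idealPow_of_mem_idealPow_two hb hy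
  · simp only [add_lie, lie_add]; abel

/-- The lower central series of an ideal splits, over a semisimple subalgebra, into layers generated
by the first one. -/
theorem exists_layers [CharZero K] [FiniteDimensional K g] [LieAlgebra.IsKilling K s]
    (n : LieIdeal K g) : ∃ f : ℕ → LieSubmodule K s g,
      (∀ k, f k ⊔ s.ofIdeal (idealPow n (k + 2)) = s.ofIdeal (idealPow n (k + 1))) ∧
      (∀ k, f k ⊓ s.ofIdeal (idealPow n (k + 2)) = ⊥) ∧
      ∀ k, f (k + 1) ≤ bracketSpan (f 0) (f k) := by
  choose C hCle hCsup hCinf using LieModule.exists_le_sup_eq_inf_eq_bot (K := K) (L := s) (M := g)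
  have hCsup' {W A U : LieSubmodule K s g} (h : W ⊔ A = U) : C W A ⊔ A = U := by
    conv_rhs => rw [← h, ← hCsup W A, sup_assoc, sup_eq_right.mpr (inf_le_right : W ⊓ A ≤ A)]
  let f₀ := C (s.ofIdeal n) (s.ofIdeal (idealPow n 2))
  let f : ℕ → LieSubmodule K s g := fun k =>
    Nat.rec f₀ (fun j B => C (bracketSpan f₀ B) (s.ofIdeal (idealPow n (j + 3)))) k
  have h₀ : f₀ ⊔ s.ofIdeal (idealPow n 2) = s.ofIdeal n :=
    hCsup' (sup_eq_left.mpr (idealPow_succ_le_self n 1))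
  refine ⟨f, fun k => ?_, fun k => ?_, fun k => hCle _ _⟩
  · induction k with
    | zero => exact h₀
    | succ k ih => exact hCsup' (bracketSpan_sup_eq h₀ ih)
  · cases k with
    | zero => exact hCinf _ _
    | succ k => exact hCinf _ _

theorem lie_eq_zero_of_bracketSpan_layers {n : LieIdeal K g} {f : ℕ → LieSubmodule K s g}
    (hf : ∀ k, f k ⊔ s.ofIdeal (idealPow n (k + 2)) = s.ofIdeal (idealPow n (k + 1)))
    (hfb : ∀ k, f (k + 1) ≤ bracketSpan (f 0) (f k)) {x : g} (hx : ∀ u ∈ f 0, ⁅x, u⁆ = 0)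
    {t : ℕ} (ht : idealPow n (t + 1) = ⊥) {u : g} (hu : u ∈ n) : ⁅x, u⁆ = 0 := by
  have hlayer (k : ℕ) : ∀ u ∈ f k, ⁅x, u⁆ = 0 := by
    induction k with
    | zero => exact hx
    | succ k ih =>
      intro u hu
      replace hu : u ∈ Submodule.span K {z : g | ∃ u ∈ f 0, ∃ v ∈ f k, z = ⁅u, v⁆} := hfb k hu
      induction hu using Submodule.span_induction with
      | mem _ h =>
        obtain ⟨a, ha, b, hb, rfl⟩ := h
        rw [leibniz_lie, hx a ha, ih b hb, zero_lie, lie_zero, add_zero]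
      | zero => simp
      | add _ _ _ _ h₁ h₂ => rw [lie_add, h₁, h₂, add_zero]
      | smul r _ _ h => rw [lie_smul, h, smul_zero]
  have hpow (j : ℕ) (hj : j ≤ t) : ∀ u ∈ idealPow n (j + 1), ⁅x, u⁆ = 0 := by
    induction hj using Nat.decreasingInduction with
    | self => simp [ht]
    | of_succ k _ ih =>
      intro u hu
      obtain ⟨a, ha, b, hb, rfl⟩ := (LieSubmodule.mem_sup _ _ _).mp ((hf k).ge hu)
      rw [lie_add, hlayer k a ha, ih b hb, add_zero]
  exact hpow 0 t.zero_le u hu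

theorem eq_zero_of_lie_eq_zero_of_indecomposable [CharZero K] [FiniteDimensional K g]
    [LieAlgebra.IsKilling K s] {n : LieIdeal K g} (hn : n ≠ ⊥)
    (hindec : ∀ I J : LieIdeal K g, I ⊓ J = ⊥ → I ⊔ J = ⊤ → I = ⊥ ∨ J = ⊥)
    (hinf : s.toSubmodule ⊓ n.toSubmodule = ⊥) (hsup : s.toSubmodule ⊔ n.toSubmodule = ⊤)
    {x : g} (hxs : x ∈ s) (hx : ∀ u ∈ n, ⁅x, u⁆ = 0) : x = 0 := by
  have hdec (z : g) : ∃ a : s, ∃ b ∈ n, (a : g) + b = z := by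
    obtain ⟨a, ha, b, hb, rfl⟩ := Submodule.mem_sup.mp
      (hsup ▸ Submodule.mem_top : z ∈ s.toSubmodule ⊔ n.toSubmodule)
    exact ⟨⟨a, ha⟩, b, hb, rfl⟩
  have hdisj {z : g} (hz : z ∈ s) (hz' : z ∈ n) : z = 0 := by
    have : z ∈ s.toSubmodule ⊓ n.toSubmodule := ⟨hz, hz'⟩
    simpa [hinf] using this
  let I : LieIdeal K g :=
    { carrier := {y | y ∈ s ∧ ∀ u ∈ n, ⁅y, u⁆ = 0}
      zero_mem' := by simp [s.zero_mem]
      add_mem' := fun {y z} hy hz =>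
        ⟨s.add_mem hy.1 hz.1, fun u hu => by rw [add_lie, hy.2 u hu, hz.2 u hu, add_zero]⟩
      smul_mem' := fun r y hy =>
        ⟨s.smul_mem r hy.1, fun u hu => by rw [smul_lie, hy.2 u hu, smul_zero]⟩
      lie_mem := fun {z y} hy => by
        obtain ⟨a, b, hb, rfl⟩ := hdec z
        have hby : ⁅b, y⁆ = 0 := by rw [← lie_skew, hy.2 b hb, neg_zero]
        change _ ∈ s ∧ _
        rw [add_lie, hby, add_zero]
        refine ⟨s.lie_mem a.2 hy.1, fun u hu => ?_⟩
        rw [lie_lie, hy.2 u hu, hy.2 _ (lie_mem_right K g n a u hu), lie_zero, sub_zero] }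
  let S₀ : LieIdeal K s :=
    { I.toSubmodule.comap s.toSubmodule.subtype with
      lie_mem := fun {a y} hy => I.lie_mem (x := (a : g)) hy }
  let S₁ := S₀.killingCompl
  have hcompl : IsCompl S₀ S₁ := S₀.isCompl_killingCompl
  let J : LieIdeal K g :=
    { S₁.toSubmodule.map s.toSubmodule.subtype ⊔ n.toSubmodule with
      lie_mem := fun {z y} hy => by
        obtain ⟨_, ⟨a, ha, rfl⟩, b, hb, rfl⟩ := Submodule.mem_sup.mp hy
        obtain ⟨c, d, hd, rfl⟩ := hdec z
        refine Submodule.mem_sup.mpr ⟨_, ⟨⁅c, a⁆, S₁.lie_mem ha, rfl⟩,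
          ⁅(c : g), b⁆ + ⁅d, (a : g) + b⁆,
          n.add_mem (lie_mem_right K g n _ b hb) (lie_mem_left K g n d _ hd), ?_⟩
        change ⁅(c : g), (a : g)⁆ + _ = ⁅(c : g) + d, (a : g) + b⁆
        simp only [add_lie, lie_add]
        abel }
  have hIJ : I ⊓ J = ⊥ := by
    rw [_root_.eq_bot_iff]
    rintro y ⟨hyI, hyJ⟩
    obtain ⟨_, ⟨a, ha, rfl⟩, b, hb, rfl⟩ := Submodule.mem_sup.mp hyJ
    have hb0 : b = 0 := hdisj (by simpa using s.sub_mem hyI.1 a.2) hb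
    subst hb0
    rw [add_zero] at hyI ⊢
    have : a ∈ S₀ ⊓ S₁ := ⟨hyI, ha⟩
    rw [hcompl.inf_eq_bot] at this
    simpa using this
  have hIJ' : I ⊔ J = ⊤ := by
    rw [eq_top_iff]
    intro z _
    obtain ⟨a, b, hb, rfl⟩ := hdec z
    obtain ⟨a₀, h₀, a₁, h₁, rfl⟩ := (LieSubmodule.mem_sup _ _ _).mp
      (hcompl.sup_eq_top ▸ LieSubmodule.mem_top a : a ∈ S₀ ⊔ S₁)
    exact (LieSubmodule.mem_sup _ _ _).mpr
      ⟨a₀, h₀, a₁ + b, Submodule.mem_sup.mpr ⟨a₁, ⟨a₁, h₁, rfl⟩, b, hb, rfl⟩, by simp [add_assoc]⟩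
  rcases hindec I J hIJ hIJ' with h | h
  · have : x ∈ I := ⟨hxs, hx⟩
    simpa [h] using this
  · refine absurd (_root_.eq_bot_iff.mpr fun y hy => ?_) hn
    rw [← h]
    exact Submodule.mem_sup_right hy

/-- A module contained in the bracket of `A` and `B` is the image of an equivariant bilinear map on
`A × B`. -/
theorem exists_bilinear_of_le_bracketSpan [CharZero K] [FiniteDimensional K g]
    [LieAlgebra.IsKilling K s] {A B C : LieSubmodule K s g} (hC : C ≤ bracketSpan A B) :
    ∃ φ : g →ₗ[K] g →ₗ[K] g, (∀ u v, φ u v ∈ C) ∧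
      (∀ x ∈ s, ∀ u v, φ ⁅x, u⁆ v + φ u ⁅x, v⁆ = ⁅x, φ u v⁆) ∧
      C.toSubmodule ≤ Submodule.span K {z : g | ∃ u ∈ A, ∃ v ∈ B, z = φ u v} := by
  obtain ⟨p, hp⟩ := LieModule.exists_projection C
  let q : g →ₗ[K] g := C.toSubmodule.subtype ∘ₗ (p : g →ₗ[K] C)
  have hq (z : g) : q z = p z := rfl
  refine ⟨LinearMap.compr₂ (LieModule.toEnd K g g : g →ₗ[K] Module.End K g) q,
    fun u v => (p _).2, fun x hx u v => ?_, fun z hz => ?_⟩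
  · change q ⁅⁅x, u⁆, v⁆ + q ⁅u, ⁅x, v⁆⁆ = ⁅x, q ⁅u, v⁆⁆
    rw [← map_add, ← leibniz_lie, hq, hq]
    exact congrArg Subtype.val (p.map_lie ⟨x, hx⟩ ⁅u, v⁆)
  · have hqz : q z = z := congrArg Subtype.val (hp ⟨z, hz⟩)
    rw [← hqz]
    have := Submodule.mem_map_of_mem (f := q) (hC hz)
    refine Submodule.span_mono ?_ (Submodule.map_span q _ ▸ this)
    rintro _ ⟨_, ⟨u, hu, v, hv, rfl⟩, rfl⟩
    exact ⟨u, hu, v, hv, rfl⟩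

end LieSubalgebra

end

/-- **Snobl, 2010.** Let `g` be an indecomposable finite-dimensional Lie algebra over a field of
characteristic zero whose solvable radical `n` is nilpotent of nilindex `t+1`, with a nontrivial
Levi decomposition `g = s ⊕ n`.  Then `n` decomposes as a direct sum of `s`-modules
`n = m₁ ⊕ ⋯ ⊕ m_t` with `n^j = m_j ⊕ n^{j+1}`, `m_j ⊆ [m₁, m_{j-1}]`, `m₁` faithful, and each
`m_j` (for `j ≥ 2`) a sum of irreducible components of `m₁ ⊗ m_{j-1}` (expressed here by a
surjective `s`-equivariant bilinear map `m₁ × m_{j-1} → m_j`). -/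
theorem snobl_decomposition
    (K : Type*) [Field K] [CharZero K]
    (g : Type*) [LieRing g] [LieAlgebra K g] [FiniteDimensional K g]
    (hindec : ∀ I J : LieIdeal K g, I ⊓ J = ⊥ → I ⊔ J = ⊤ → I = ⊥ ∨ J = ⊥)
    (s : LieSubalgebra K g) (hss : LieAlgebra.IsSemisimple K ↥s) (hsne : s ≠ ⊥)
    (hlevi_inf : s.toSubmodule ⊓ LieSubmodule.toSubmodule (LieAlgebra.radical K g) = ⊥)
    (hlevi_sup : s.toSubmodule ⊔ LieSubmodule.toSubmodule (LieAlgebra.radical K g) = ⊤)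
    (t : ℕ) (ht : 1 ≤ t)
    (hnil : idealPow (LieAlgebra.radical K g) (t + 1) = ⊥)
    (hnil' : idealPow (LieAlgebra.radical K g) t ≠ ⊥) :
    ∃ m : ℕ → Submodule K g,
      (LieSubmodule.toSubmodule (LieAlgebra.radical K g) = ⨆ j ∈ Finset.Icc 1 t, m j) ∧
      (∀ j, 1 ≤ j → j ≤ t → ∀ x ∈ s, ∀ u ∈ m j, ⁅x, u⁆ ∈ m j) ∧
      (∀ j, 1 ≤ j → j ≤ t →
        LieSubmodule.toSubmodule (idealPow (LieAlgebra.radical K g) j) =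
          m j ⊔ LieSubmodule.toSubmodule (idealPow (LieAlgebra.radical K g) (j + 1)) ∧
        m j ⊓ LieSubmodule.toSubmodule (idealPow (LieAlgebra.radical K g) (j + 1)) = ⊥) ∧
      (∀ j, 2 ≤ j → j ≤ t →
        m j ≤ Submodule.span K {z : g | ∃ u ∈ m 1, ∃ v ∈ m (j - 1), z = ⁅u, v⁆}) ∧
      (∀ x ∈ s, (∀ u ∈ m 1, ⁅x, u⁆ = 0) → x = 0) ∧
      (∀ j, 2 ≤ j → j ≤ t →
        ∃ φ : g →ₗ[K] g →ₗ[K] g,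
          (∀ u ∈ m 1, ∀ v ∈ m (j - 1), φ u v ∈ m j) ∧
          (∀ x ∈ s, ∀ u ∈ m 1, ∀ v ∈ m (j - 1),
            φ ⁅x, u⁆ v + φ u ⁅x, v⁆ = ⁅x, φ u v⁆) ∧
          m j ≤ Submodule.span K {z : g | ∃ u ∈ m 1, ∃ v ∈ m (j - 1), z = φ u v}) := by
  have hK : LieAlgebra.IsKilling K s := inferInstance
  set n := LieAlgebra.radical K g
  obtain ⟨f, hfsup, hfinf, hfb⟩ := LieSubalgebra.exists_layers (s := s) n
  have hn : n ≠ ⊥ := fun h => hnil' <| by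
    obtain ⟨k, rfl⟩ := Nat.exists_eq_add_of_le' ht
    exact eq_bot_iff.mpr ((idealPow_succ_le_self n k).trans h.le)
  have hlayer (k : ℕ) : (idealPow n (k + 1)).toSubmodule =
      (f k).toSubmodule ⊔ (idealPow n (k + 2)).toSubmodule := by
    simpa using (congrArg LieSubmodule.toSubmodule (hfsup k)).symm
  have hsum (k : ℕ) : n.toSubmodule =
      (⨆ j ∈ Finset.Icc 1 k, (f (j - 1)).toSubmodule) ⊔ (idealPow n (k + 1)).toSubmodule := by
    induction k with
    | zero => simp [idealPow]
    | succ k ih =>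
      rw [← Finset.insert_Icc_right_eq_Icc_add_one (by omega), Finset.iSup_insert, ih, hlayer k]
      simp only [add_tsub_cancel_right]
      ac_rfl
  refine ⟨fun j => (f (j - 1)).toSubmodule, ?_, ?_, ?_, ?_, ?_, ?_⟩
  · simpa [hnil] using hsum t
  · exact fun j _ _ x hx u hu => (f (j - 1)).lie_mem (x := ⟨x, hx⟩) hu
  · intro j hj _
    obtain ⟨k, rfl⟩ := Nat.exists_eq_add_of_le' hj
    exact ⟨hlayer k, by simpa using congrArg LieSubmodule.toSubmodule (hfinf k)⟩
  · intro j hj _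
    obtain ⟨k, rfl⟩ := Nat.exists_eq_add_of_le' hj
    exact hfb k
  · exact fun x hx hx0 => LieSubalgebra.eq_zero_of_lie_eq_zero_of_indecomposable hn hindec
      hlevi_inf hlevi_sup hx fun u hu =>
        LieSubalgebra.lie_eq_zero_of_bracketSpan_layers hfsup hfb hx0 hnil hu
  · intro j hj _
    obtain ⟨k, rfl⟩ := Nat.exists_eq_add_of_le' hj
    obtain ⟨φ, hφ, hφ', hφspan⟩ := LieSubalgebra.exists_bilinear_of_le_bracketSpan (hfb k)
    exact ⟨φ, fun u _ v _ => hφ u v, fun x hx u _ v _ => hφ' x hx u v, hφspan⟩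
end

section
/- Let s be a simple Lie algebra over a field of characteristic zero and let m₁, ..., m_t be irreducible s-modules with representations ρ_i : s → gl(m_i), where ρ₁ is faithful. Suppose given s-module homomorphisms p_{ijk} : m_i ⊗ m_j → m_k for 1 ≤ i ≤ j ≤ k ≤ t with i + j ≤ k, such that p_{iik} is skew-symmetric for each i, p_{1j(j+1)} is nonzero for each j, and for all u ∈ m_i, v ∈ m_j, w ∈ m_k with i ≤ j ≤ k and i + j + k ≤ t one has Σ_{l=j+k}^{t−i} Σ_{r=i+l}^{t} p_{ilr}(u, p_{jkl}(v,w)) − Σ_{l=i+k}^{t−j} Σ_{r=j+l}^{t} p_{jlr}(v, p_{ikl}(u,w)) + Σ_{l=i+j}^{t−k} Σ_{r=k+l}^{t} p̂_{klr}(w, p_{ijl}(u,v)) = 0, where p̂_{klr} = p_{klr} if k ≤ l and p̂_{klr} = −p_{lkr} otherwise. Then the vector space g = s ⊕ m₁ ⊕ m₂ ⊕ ... ⊕ m_t with bracket given by the Lie bracket of s on s, by [s',u] = ρ_i(s')(u) for s' ∈ s and u ∈ m_i, and by [u,v] = Σ_{k=i+j}^{t} p_{ijk}(u,v) for u ∈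 m_i, v ∈ m_j with i ≤ j, is a Lie algebra whose lattice of ideals is the (t+2)-element chain 0 < m_t < m_{t−1} ⊕ m_t < ... < m₁ ⊕ m₂ ⊕ ... ⊕ m_t < g. -/
/-- A (bilinear) Lie bracket on a `K`-module. -/
structure IsLieBracket (K : Type*) [CommRing K] (M : Type*) [AddCommGroup M] [Module K M]
    (br : M → M → M) : Prop where
  add_left : ∀ x y z : M, br (x + y) z = br x z + br y z
  smul_left : ∀ (c : K) (x y : M), br (c • x) y = c • br x y
  skew : ∀ x y : M, br x y = - br y x
  jacobi : ∀ x y z : M, br (br x y) z + br (br z x) y + br (br y z) x = 0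

/-- A submodule is an ideal for a bracket if it absorbs the bracket. -/
def IsBrIdeal (K : Type*) [CommRing K] {M : Type*} [AddCommGroup M] [Module K M]
    (br : M → M → M) (S : Submodule K M) : Prop :=
  ∀ x : M, ∀ s ∈ S, br x s ∈ S

/-- The submodule `m_k ⊕ m_{k+1} ⊕ ⋯ ⊕ m_t` of `s × (m₁ × ⋯ × m_t)`. -/
def tailT (K : Type*) [Field K] (s : Type*) [AddCommGroup s] [Module K s]
    (t : ℕ) (m : ℕ → Type*) [∀ i, AddCommGroup (m i)] [∀ i, Module K (m i)] (k : ℕ) :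
    Submodule K (s × ((i : Fin t) → m (i.1 + 1))) :=
  (⊥ : Submodule K s).prod
    (Submodule.pi Set.univ (fun i : Fin t =>
      if k ≤ i.1 + 1 then (⊤ : Submodule K (m (i.1 + 1))) else ⊥))

section Semidirect

variable {K : Type*} [Field K] {s : Type*} [LieRing s] [LieAlgebra K s]
  {M : Type*} [AddCommGroup M] [Module K M]

/-- The bracket on `s × M` built from an action of `s` on `M` and a product on `M`. -/
def semidirectBracket (R : s →ₗ[K] M →ₗ[K] M) (B : M →ₗ[K] M →ₗ[K] M) (a b : s × M) : s × M :=
  (⁅a.1, b.1⁆, R a.1 b.2 - R b.1 a.2 + B a.2 b.2)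

theorem isLieBracket_semidirectBracket (R : s →ₗ[K] M →ₗ[K] M) (B : M →ₗ[K] M →ₗ[K] M)
    (hR : ∀ x y f, R ⁅x, y⁆ f = R x (R y f) - R y (R x f))
    (hB : ∀ f g, B f g = - B g f)
    (hRB : ∀ x f g, R x (B f g) = B (R x f) g + B f (R x g))
    (hJ : ∀ f g h, B f (B g h) - B g (B f h) + B h (B f g) = 0) :
    IsLieBracket K (s × M) (semidirectBracket R B) where
  add_left := by
    rintro ⟨x, f⟩ ⟨y, g⟩ ⟨z, h⟩
    ext
    · simp [semidirectBracket]
    · simp only [semidirectBracket, Prod.mk_add_mk, map_add, LinearMap.add_apply]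
      abel
  smul_left := by
    rintro c ⟨x, f⟩ ⟨y, g⟩
    ext
    · simp [semidirectBracket]
    · simp [semidirectBracket, smul_add, smul_sub]
  skew := by
    rintro ⟨x, f⟩ ⟨y, g⟩
    ext
    · simp [semidirectBracket]
    · simp only [semidirectBracket, Prod.neg_mk]
      rw [hB g f]
      abel
  jacobi := by
    rintro ⟨x, f⟩ ⟨y, g⟩ ⟨z, h⟩
    ext
    · simp only [semidirectBracket, Prod.mk_add_mk, Prod.fst_zero]
      have := lie_jacobi x y z
      rw [← lie_skew ⁅x, y⁆ z, ← lie_skew ⁅z, x⁆ y, ← lie_skew ⁅y, z⁆ x]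
      rw [← neg_eq_zero, ← this]
      abel
    · simp only [semidirectBracket, Prod.mk_add_mk, Prod.snd_zero, map_add, map_sub,
        LinearMap.add_apply, LinearMap.sub_apply, hR, hRB]
      rw [hB f (R z g), hB h (R y f), hB g (R x h), hB (B f g), hB (B h f), hB (B g h), hB h f,
        map_neg]
      have := hJ f g h
      rw [← neg_eq_zero, ← this]
      abel

theorem IsBrIdeal.bracket_mem_left {R : s →ₗ[K] M →ₗ[K] M} {B : M →ₗ[K] M →ₗ[K] M}
    (hL : IsLieBracket K (s × M) (semidirectBracket R B)) {S : Submodule K (s × M)}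
    (hS : IsBrIdeal K (semidirectBracket R B) S) {a : s × M} (ha : a ∈ S) (b : s × M) :
    semidirectBracket R B a b ∈ S := by
  rw [hL.skew]
  exact S.neg_mem (hS b a ha)

theorem semidirectBracket_add_right {R : s →ₗ[K] M →ₗ[K] M} {B : M →ₗ[K] M →ₗ[K] M}
    (a b c : s × M) :
    semidirectBracket R B a (b + c) = semidirectBracket R B a b + semidirectBracket R B a c := by
  ext
  · simp [semidirectBracket]
  · simp only [semidirectBracket, Prod.fst_add, Prod.snd_add, map_add, LinearMap.add_apply]
    abel

theorem IsBrIdeal.sup {R : s →ₗ[K] M →ₗ[K] M} {B : M →ₗ[K] M →ₗ[K] M}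
    {S T : Submodule K (s × M)} (hS : IsBrIdeal K (semidirectBracket R B) S)
    (hT : IsBrIdeal K (semidirectBracket R B) T) :
    IsBrIdeal K (semidirectBracket R B) (S ⊔ T) := by
  intro x z hz
  obtain ⟨a, ha, b, hb, rfl⟩ := Submodule.mem_sup.1 hz
  rw [semidirectBracket_add_right]
  exact Submodule.add_mem_sup (hS x a ha) (hT x b hb)

/-- An ideal of `s × M`, for `s` simple, projects onto `s` or lies in `M`. -/
theorem IsBrIdeal.fst_eq_zero_or_surjective [LieAlgebra.IsSimple K s]
    {R : s →ₗ[K] M →ₗ[K] M} {B : M →ₗ[K] M →ₗ[K] M}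
    {S : Submodule K (s × M)} (hS : IsBrIdeal K (semidirectBracket R B) S) :
    (∀ z ∈ S, z.1 = 0) ∨ ∀ x : s, ∃ f, (x, f) ∈ S := by
  let I : LieIdeal K s :=
    { S.map (LinearMap.fst K s M) with
      lie_mem := by
        rintro x _ ⟨z, hz, rfl⟩
        exact ⟨_, hS (x, 0) z hz, rfl⟩ }
  have hI : ∀ x, x ∈ I ↔ ∃ f, (x, f) ∈ S := by
    intro x
    change x ∈ S.map (LinearMap.fst K s M) ↔ _
    simp
  rcases LieAlgebra.IsSimple.eq_bot_or_eq_top (R := K) I with h | h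
  · left
    intro z hz
    have : z.1 ∈ I := (hI _).2 ⟨z.2, hz⟩
    simpa [h] using this
  · right
    intro x
    rw [← hI, h]
    trivial

end Semidirect

section Graded

variable {K : Type*} [Field K] {m : ℕ → Type*} [∀ i, AddCommGroup (m i)] [∀ i, Module K (m i)]

/-- The skew extension to all pairs of indices of the products `p i j k`, `i ≤ j`,
set to zero unless `i + j ≤ k`. -/
def skewExtension (p : (i j k : ℕ) → m i →ₗ[K] m j →ₗ[K] m k) (i j k : ℕ) :
    m i →ₗ[K] m j →ₗ[K] m k :=
  if i + j ≤ k then (if i ≤ j then p i j k else -(p j i k).flip) else 0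

variable {p : (i j k : ℕ) → m i →ₗ[K] m j →ₗ[K] m k}

theorem skewExtension_of_le {i j k : ℕ} (h : i + j ≤ k) (hij : i ≤ j) :
    skewExtension p i j k = p i j k := by
  simp [skewExtension, h, hij]

theorem skewExtension_of_lt {i j k : ℕ} (h : k < i + j) : skewExtension p i j k = 0 := by
  simp [skewExtension, h]

theorem skewExtension_skew {t : ℕ}
    (hskew : ∀ i k, 1 ≤ i → i + i ≤ k → k ≤ t → ∀ u v : m i, p i i k u v = - p i i k v u)
    {i j k : ℕ} (hi : 1 ≤ i) (hk : k ≤ t) (u : m i) (v : m j) :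
    skewExtension p i j k u v = - skewExtension p j i k v u := by
  rcases lt_trichotomy i j with h | rfl | h
  · simp [skewExtension, h.le, h.not_ge, add_comm j i]
    split_ifs <;> simp
  · by_cases h : i + i ≤ k
    · rw [skewExtension_of_le h le_rfl]
      exact hskew i k hi h hk u v
    · rw [skewExtension_of_lt (not_le.1 h)]
      simp
  · simp [skewExtension, h.le, h.not_ge, add_comm j i]
    split_ifs <;> simp

theorem skewExtension_equivariant {s : Type*} [AddCommGroup s] [Module K s] {t : ℕ}
    {ρ : (i : ℕ) → s →ₗ[K] m i →ₗ[K] m i}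
    (hequiv : ∀ i j k, 1 ≤ i → i ≤ j → j ≤ k → k ≤ t → i + j ≤ k →
      ∀ (x : s) (u : m i) (v : m j),
        p i j k (ρ i x u) v + p i j k u (ρ j x v) = ρ k x (p i j k u v))
    {i j k : ℕ} (hi : 1 ≤ i) (hj : 1 ≤ j) (hk : k ≤ t) (x : s) (u : m i) (v : m j) :
    ρ k x (skewExtension p i j k u v) =
      skewExtension p i j k (ρ i x u) v + skewExtension p i j k u (ρ j x v) := by
  by_cases h : i + j ≤ k
  · by_cases hij : i ≤ j
    · simp only [skewExtension_of_le h hij]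
      exact (hequiv i j k hi hij (by lia) hk h x u v).symm
    · simp only [skewExtension, h, hij, if_true, if_false, LinearMap.neg_apply,
        LinearMap.flip_apply, map_neg]
      rw [← hequiv j i k hj (by lia) (by lia) hk (by lia) x v u]
      abel
  · rw [skewExtension_of_lt (not_le.1 h)]
    simp

/-- The Jacobiator of homogeneous elements, in degree `r`, for a graded product `q`. -/
def gradedJacobiator (q : (i j k : ℕ) → m i →ₗ[K] m j →ₗ[K] m k) (t i j k r : ℕ)
    (u : m i) (v : m j) (w : m k) : m r :=
  (∑ l ∈ Finset.Icc 1 t, q i l r u (q j k l v w)) - (∑ l ∈ Finset.Icc 1 t, q j l r v (q i k l u w))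
    + ∑ l ∈ Finset.Icc 1 t, q k l r w (q i j l u v)

theorem gradedJacobiator_swap_left {q : (i j k : ℕ) → m i →ₗ[K] m j →ₗ[K] m k} {t i j k r : ℕ}
    (hq : ∀ l ≤ t, ∀ (u : m i) (v : m j), q i j l u v = - q j i l v u)
    (u : m i) (v : m j) (w : m k) :
    gradedJacobiator q t i j k r u v w = - gradedJacobiator q t j i k r v u w := by
  have : ∑ l ∈ Finset.Icc 1 t, q k l r w (q i j l u v) =
      - ∑ l ∈ Finset.Icc 1 t, q k l r w (q j i l v u) := by
    rw [← Finset.sum_neg_distrib]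
    refine Finset.sum_congr rfl fun l hl => ?_
    rw [hq l (Finset.mem_Icc.1 hl).2 u v, map_neg]
  rw [gradedJacobiator, gradedJacobiator, this]
  abel

theorem gradedJacobiator_swap_right {q : (i j k : ℕ) → m i →ₗ[K] m j →ₗ[K] m k} {t i j k r : ℕ}
    (hq : ∀ l ≤ t, ∀ (v : m j) (w : m k), q j k l v w = - q k j l w v)
    (u : m i) (v : m j) (w : m k) :
    gradedJacobiator q t i j k r u v w = - gradedJacobiator q t i k j r u w v := by
  have : ∑ l ∈ Finset.Icc 1 t, q i l r u (q j k l v w) =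
      - ∑ l ∈ Finset.Icc 1 t, q i l r u (q k j l w v) := by
    rw [← Finset.sum_neg_distrib]
    refine Finset.sum_congr rfl fun l hl => ?_
    rw [hq l (Finset.mem_Icc.1 hl).2 v w, map_neg]
  rw [gradedJacobiator, gradedJacobiator, this]
  abel

theorem sum_skewExtension_comp {t i j k r : ℕ} (hj : 1 ≤ j) (hi : 1 ≤ i) (hr : r ≤ t)
    (u : m i) (v : m j) (w : m k) :
    ∑ l ∈ Finset.Icc 1 t, skewExtension p i l r u (skewExtension p j k l v w) =
      ∑ l ∈ Finset.Icc (j + k) (r - i),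
        skewExtension p i l r u (skewExtension p j k l v w) := by
  symm
  refine Finset.sum_subset (fun l hl => ?_) (fun l hl hl' => ?_)
  · simp only [Finset.mem_Icc] at hl ⊢
    lia
  · simp only [Finset.mem_Icc, not_and, not_le] at hl hl'
    by_cases h : j + k ≤ l
    · rw [skewExtension_of_lt (p := p) (i := i) (by have := hl' h; lia)]
      simp
    · rw [skewExtension_of_lt (p := p) (i := j) (by lia)]
      simp

theorem gradedJacobiator_skewExtension_eq_zero {t : ℕ}
    (hskew : ∀ i k, 1 ≤ i → i + i ≤ k → k ≤ t → ∀ u v : m i, p i i k u v = - p i i k v u)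
    (hjacobi : ∀ i j k r, 1 ≤ i → i ≤ j → j ≤ k → i + j + k ≤ t → r ≤ t →
      ∀ (u : m i) (v : m j) (w : m k),
        (∑ l ∈ Finset.Icc (j + k) (r - i), p i l r u (p j k l v w))
        - (∑ l ∈ Finset.Icc (i + k) (r - j), p j l r v (p i k l u w))
        + (∑ l ∈ Finset.Icc (i + j) (r - k),
            if k ≤ l then p k l r w (p i j l u v) else - p l k r (p i j l u v) w) = 0)
    {i j k r : ℕ} (hi : 1 ≤ i) (hj : 1 ≤ j) (hk : 1 ≤ k) (hr : r ≤ t)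
    (u : m i) (v : m j) (w : m k) :
    gradedJacobiator (skewExtension p) t i j k r u v w = 0 := by
  have sorted : ∀ i j k, 1 ≤ i → i ≤ j → j ≤ k → ∀ (u : m i) (v : m j) (w : m k),
      gradedJacobiator (skewExtension p) t i j k r u v w = 0 := by
    intro i j k hi hij hjk u v w
    rw [gradedJacobiator, sum_skewExtension_comp (by lia) hi hr,
      sum_skewExtension_comp hi (by lia) hr, sum_skewExtension_comp hi (by lia) hr]
    by_cases hsum : i + j + k ≤ t
    · rw [← hjacobi i j k r hi hij hjk hsum hr u v w]
      congr 1
      · congr 1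
        · refine Finset.sum_congr rfl fun l hl => ?_
          rw [Finset.mem_Icc] at hl
          rw [skewExtension_of_le (by lia) (by lia), skewExtension_of_le (by lia) (by lia)]
        · refine Finset.sum_congr rfl fun l hl => ?_
          rw [Finset.mem_Icc] at hl
          rw [skewExtension_of_le (by lia) (by lia), skewExtension_of_le (by lia) (by lia)]
      · refine Finset.sum_congr rfl fun l hl => ?_
        rw [Finset.mem_Icc] at hl
        rw [skewExtension_of_le (i := i) (by lia) (by lia), skewExtension, if_pos (by lia)]
        split_ifs <;> rfl
    · rw [Finset.Icc_eq_empty (by lia), Finset.Icc_eq_empty (by lia),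
        Finset.Icc_eq_empty (by lia)]
      simp
  have left : ∀ i j k, 1 ≤ i → ∀ (u : m i) (v : m j) (w : m k),
      gradedJacobiator (skewExtension p) t i j k r u v w =
        - gradedJacobiator (skewExtension p) t j i k r v u w := fun i j k hi =>
    gradedJacobiator_swap_left fun l hl => skewExtension_skew hskew hi hl
  have right : ∀ i j k, 1 ≤ j → ∀ (u : m i) (v : m j) (w : m k),
      gradedJacobiator (skewExtension p) t i j k r u v w =
        - gradedJacobiator (skewExtension p) t i k j r u w v := fun i j k hj =>
    gradedJacobiator_swap_right fun l hl => skewExtension_skew hskew hj hl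
  rcases le_total i j with hij | hij <;> rcases le_total j k with hjk | hjk <;>
    rcases le_total i k with hik | hik
  · exact sorted i j k hi hij hjk u v w
  · exact sorted i j k hi hij hjk u v w
  · rw [right i j k hj, sorted i k j hi hik hjk, neg_zero]
  · rw [right i j k hj, left i k j hi, sorted k i j hk hik hij, neg_zero, neg_zero]
  · rw [left i j k hi, sorted j i k hj hij hik, neg_zero]
  · rw [left i j k hi, right j i k hi, sorted j k i hj hjk hik, neg_zero, neg_zero]
  · rw [left i j k hi, right j i k hi, left j k i hj, sorted k j i hk hjk hij]
    simp
  · rw [left i j k hi, right j i k hi, left j k i hj, sorted k j i hk hjk hij]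
    simp

variable {t : ℕ}

/-- The product on `m₁ × ⋯ × m_t` with homogeneous components `skewExtension p`. -/
def gradedProduct (p : (i j k : ℕ) → m i →ₗ[K] m j →ₗ[K] m k) (t : ℕ) :
    ((i : Fin t) → m (i.1 + 1)) →ₗ[K] ((i : Fin t) → m (i.1 + 1)) →ₗ[K]
      ((i : Fin t) → m (i.1 + 1)) :=
  LinearMap.mk₂ K
    (fun f g r => ∑ i : Fin t, ∑ j : Fin t,
      skewExtension p (i.1 + 1) (j.1 + 1) (r.1 + 1) (f i) (g j))
    (fun f f' g => by ext r; simp [Finset.sum_add_distrib])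
    (fun c f g => by ext r; simp [Finset.smul_sum])
    (fun f g g' => by ext r; simp [Finset.sum_add_distrib])
    (fun c f g => by ext r; simp [Finset.smul_sum])

theorem gradedProduct_apply (f g : (i : Fin t) → m (i.1 + 1)) (r : Fin t) :
    gradedProduct p t f g r = ∑ i : Fin t, ∑ j : Fin t,
      skewExtension p (i.1 + 1) (j.1 + 1) (r.1 + 1) (f i) (g j) := rfl

theorem gradedProduct_single_single (i j r : Fin t) (u : m (i.1 + 1)) (v : m (j.1 + 1)) :
    gradedProduct p t (Pi.single i u) (Pi.single j v) r =
      skewExtension p (i.1 + 1) (j.1 + 1) (r.1 + 1) u v := by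
  rw [gradedProduct_apply, Finset.sum_eq_single i, Finset.sum_eq_single j]
  · simp
  · intro b _ hb
    rw [Pi.single_eq_of_ne hb, map_zero]
  · simp
  · intro b _ hb
    rw [Pi.single_eq_of_ne hb]
    simp
  · simp

theorem gradedProduct_skew
    (hskew : ∀ i k, 1 ≤ i → i + i ≤ k → k ≤ t → ∀ u v : m i, p i i k u v = - p i i k v u)
    (f g : (i : Fin t) → m (i.1 + 1)) : gradedProduct p t f g = - gradedProduct p t g f := by
  ext r
  rw [Pi.neg_apply, gradedProduct_apply, gradedProduct_apply, Finset.sum_comm]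
  simp only [← Finset.sum_neg_distrib]
  exact Finset.sum_congr rfl fun i _ => Finset.sum_congr rfl fun j _ =>
    skewExtension_skew hskew (by lia) (by lia) _ _

theorem gradedProduct_jacobi
    (hJ : ∀ i j k r, 1 ≤ i → 1 ≤ j → 1 ≤ k → r ≤ t → ∀ (u : m i) (v : m j) (w : m k),
      gradedJacobiator (skewExtension p) t i j k r u v w = 0)
    (f g h : (i : Fin t) → m (i.1 + 1)) :
    gradedProduct p t f (gradedProduct p t g h) - gradedProduct p t g (gradedProduct p t f h)
      + gradedProduct p t h (gradedProduct p t f g) = 0 := by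
  have expand : ∀ (f g h : (i : Fin t) → m (i.1 + 1)) (r : Fin t),
      gradedProduct p t f (gradedProduct p t g h) r =
        ∑ i : Fin t, ∑ j : Fin t, ∑ k : Fin t, ∑ l ∈ Finset.Icc 1 t,
          skewExtension p (i.1 + 1) l (r.1 + 1) (f i)
            (skewExtension p (j.1 + 1) (k.1 + 1) l (g j) (h k)) := by
    intro f g h r
    rw [gradedProduct_apply]
    refine Finset.sum_congr rfl fun i _ => ?_
    simp only [gradedProduct_apply, map_sum]
    rw [Finset.sum_comm]
    refine Finset.sum_congr rfl fun j _ => ?_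
    rw [Finset.sum_comm]
    refine Finset.sum_congr rfl fun k _ => ?_
    rw [Fin.sum_univ_eq_sum_range (fun l => skewExtension p (i.1 + 1) (l + 1) (r.1 + 1) (f i)
      (skewExtension p (j.1 + 1) (k.1 + 1) (l + 1) (g j) (h k)))]
    rw [Finset.range_eq_Ico, Finset.sum_Ico_add' (fun l => skewExtension p (i.1 + 1) l (r.1 + 1)
      (f i) (skewExtension p (j.1 + 1) (k.1 + 1) l (g j) (h k)))]
    rfl
  ext r
  have h₁ := expand f g h r
  have h₂ := (expand g f h r).trans Finset.sum_comm
  have h₃ := (expand h f g r).trans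
    (Finset.sum_comm.trans (Finset.sum_congr rfl fun i _ => Finset.sum_comm))
  rw [Pi.add_apply, Pi.sub_apply, h₁, h₂, h₃]
  simp only [← Finset.sum_sub_distrib, ← Finset.sum_add_distrib]
  refine Finset.sum_eq_zero fun i _ => Finset.sum_eq_zero fun j _ => Finset.sum_eq_zero fun k _ => ?_
  have := hJ (i.1 + 1) (j.1 + 1) (k.1 + 1) (r.1 + 1) (by lia) (by lia) (by lia) (by lia)
    (f i) (g j) (h k)
  rw [gradedJacobiator] at this
  simpa only [← Finset.sum_sub_distrib, ← Finset.sum_add_distrib] using this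

/-- The diagonal action on `m₁ × ⋯ × m_t`. -/
def diagonalAction {s : Type*} [AddCommGroup s] [Module K s]
    (ρ : (i : ℕ) → s →ₗ[K] m i →ₗ[K] m i) (t : ℕ) :
    s →ₗ[K] ((i : Fin t) → m (i.1 + 1)) →ₗ[K] ((i : Fin t) → m (i.1 + 1)) :=
  LinearMap.mk₂ K (fun x f i => ρ (i.1 + 1) x (f i))
    (fun x y f => by ext i; simp) (fun c x f => by ext i; simp)
    (fun x f g => by ext i; simp) (fun c x f => by ext i; simp)

theorem diagonalAction_apply {s : Type*} [AddCommGroup s] [Module K s]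
    (ρ : (i : ℕ) → s →ₗ[K] m i →ₗ[K] m i) (x : s) (f : (i : Fin t) → m (i.1 + 1)) (i : Fin t) :
    diagonalAction ρ t x f i = ρ (i.1 + 1) x (f i) := rfl

theorem diagonalAction_single {s : Type*} [AddCommGroup s] [Module K s]
    (ρ : (i : ℕ) → s →ₗ[K] m i →ₗ[K] m i) (x : s) (i : Fin t) (u : m (i.1 + 1)) :
    diagonalAction ρ t x (Pi.single i u) = Pi.single i (ρ (i.1 + 1) x u) := by
  ext j
  rw [diagonalAction_apply]
  rcases eq_or_ne j i with rfl | h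
  · simp
  · simp [Pi.single_eq_of_ne h]

theorem diagonalAction_gradedProduct {s : Type*} [AddCommGroup s] [Module K s]
    {ρ : (i : ℕ) → s →ₗ[K] m i →ₗ[K] m i}
    (hequiv : ∀ i j k, 1 ≤ i → i ≤ j → j ≤ k → k ≤ t → i + j ≤ k →
      ∀ (x : s) (u : m i) (v : m j),
        p i j k (ρ i x u) v + p i j k u (ρ j x v) = ρ k x (p i j k u v))
    (x : s) (f g : (i : Fin t) → m (i.1 + 1)) :
    diagonalAction ρ t x (gradedProduct p t f g) =
      gradedProduct p t (diagonalAction ρ t x f) g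
        + gradedProduct p t f (diagonalAction ρ t x g) := by
  ext r
  simp only [diagonalAction_apply, gradedProduct_apply, Pi.add_apply, map_sum,
    ← Finset.sum_add_distrib]
  exact Finset.sum_congr rfl fun i _ => Finset.sum_congr rfl fun j _ =>
    skewExtension_equivariant hequiv (by lia) (by lia) (by lia) x _ _

end Graded

section Tail

variable {K : Type*} [Field K] {s : Type*} [AddCommGroup s] [Module K s] {t : ℕ}
  {m : ℕ → Type*} [∀ i, AddCommGroup (m i)] [∀ i, Module K (m i)]

theorem mem_tailT {k : ℕ} {z : s × ((i : Fin t) → m (i.1 + 1))} :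
    z ∈ tailT K s t m k ↔ z.1 = 0 ∧ ∀ i : Fin t, i.1 + 1 < k → z.2 i = 0 := by
  rw [tailT, Submodule.mem_prod, Submodule.mem_bot, Submodule.mem_pi]
  refine and_congr_right fun _ => forall_congr' fun i => ?_
  by_cases h : k ≤ i.1 + 1
  · simp [h]
  · simp [h, not_le.1 h]

theorem tailT_one_iff {z : s × ((i : Fin t) → m (i.1 + 1))} :
    z ∈ tailT K s t m 1 ↔ z.1 = 0 := by
  rw [mem_tailT]
  exact ⟨And.left, fun h => ⟨h, fun i hi => by lia⟩⟩

theorem single_mem_tailT {k : ℕ} {i : Fin t} (h : k ≤ i.1 + 1) (u : m (i.1 + 1)) :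
    ((0 : s), (Pi.single i u : (i : Fin t) → m (i.1 + 1))) ∈ tailT K s t m k := by
  refine mem_tailT.2 ⟨rfl, fun j hj => Pi.single_eq_of_ne ?_ _⟩
  rintro rfl
  lia

theorem tailT_succ_eq_bot : tailT K s t m (t + 1) = ⊥ := by
  rw [eq_bot_iff]
  intro z hz
  rw [mem_tailT] at hz
  exact Prod.ext hz.1 (funext fun i => hz.2 i (by lia))

theorem tailT_mono {k l : ℕ} (h : k ≤ l) : tailT K s t m l ≤ tailT K s t m k := by
  intro z hz
  rw [mem_tailT] at hz ⊢
  exact ⟨hz.1, fun i hi => hz.2 i (by lia)⟩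

theorem sub_single_mem_tailT {k : Fin t} {z : s × ((i : Fin t) → m (i.1 + 1))}
    (hz : z ∈ tailT K s t m (k.1 + 1)) :
    z - (0, Pi.single k (z.2 k)) ∈ tailT K s t m (k.1 + 2) := by
  rw [mem_tailT] at hz ⊢
  refine ⟨by simp [hz.1], fun i hi => ?_⟩
  rw [Prod.snd_sub, Pi.sub_apply]
  rcases eq_or_ne i k with rfl | h
  · simp
  · have : i.1 ≠ k.1 := fun h' => h (Fin.ext h')
    simp [Pi.single_eq_of_ne h, hz.2 i (by lia)]

theorem tailT_le_of_forall_le_sup {S : Submodule K (s × ((i : Fin t) → m (i.1 + 1)))} {k : ℕ}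
    (hk : k ≤ t + 1) (h : ∀ l, k ≤ l → l ≤ t → tailT K s t m l ≤ S ⊔ tailT K s t m (l + 1)) :
    tailT K s t m k ≤ S := by
  have key : ∀ l, k ≤ l → l ≤ t + 1 → tailT K s t m k ≤ S ⊔ tailT K s t m l := by
    intro l hl
    induction l, hl using Nat.le_induction with
    | base => exact fun _ => le_sup_right
    | succ l hl ih =>
      exact fun hlt => (ih (by lia)).trans (sup_le le_sup_left (h l hl (by lia)))
  simpa [tailT_succ_eq_bot] using key (t + 1) hk le_rfl

theorem gradedProduct_mem_tailT {p : (i j k : ℕ) → m i →ₗ[K] m j →ₗ[K] m k} {k : ℕ}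
    (f : (i : Fin t) → m (i.1 + 1)) {g : (i : Fin t) → m (i.1 + 1)}
    (hg : ((0 : s), g) ∈ tailT K s t m k) :
    ((0 : s), gradedProduct p t f g) ∈ tailT K s t m (k + 1) := by
  rw [mem_tailT] at hg ⊢
  refine ⟨rfl, fun r hr => ?_⟩
  change gradedProduct p t f g r = 0
  rw [gradedProduct_apply]
  refine Finset.sum_eq_zero fun i _ => Finset.sum_eq_zero fun j _ => ?_
  have hj := hg.2 j
  dsimp only at hj
  by_cases h : j.1 + 1 < k
  · rw [hj h, map_zero]
  · rw [skewExtension_of_lt (by lia)]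
    simp

end Tail

section Ideals

variable {K : Type*} [Field K] {s : Type*} [LieRing s] [LieAlgebra K s] {t : ℕ}
  {m : ℕ → Type*} [∀ i, AddCommGroup (m i)] [∀ i, Module K (m i)]
  {ρ : (i : ℕ) → s →ₗ[K] m i →ₗ[K] m i} {p : (i j k : ℕ) → m i →ₗ[K] m j →ₗ[K] m k}

theorem bracket_mem_tailT_succ (f : (i : Fin t) → m (i.1 + 1)) {k : ℕ}
    {z : s × ((i : Fin t) → m (i.1 + 1))} (hz : z ∈ tailT K s t m k) :
    semidirectBracket (diagonalAction ρ t) (gradedProduct p t) (0, f) z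
      ∈ tailT K s t m (k + 1) := by
  obtain ⟨y, g⟩ := z
  obtain rfl : y = 0 := (mem_tailT.1 hz).1
  simpa [semidirectBracket] using gradedProduct_mem_tailT (p := p) f hz

theorem isBrIdeal_tailT (k : ℕ) :
    IsBrIdeal K (semidirectBracket (diagonalAction ρ t) (gradedProduct p t))
      (tailT K s t m k) := by
  rintro ⟨x, f⟩ ⟨y, g⟩ hz
  obtain rfl : y = 0 := (mem_tailT.1 hz).1
  have h₁ : ((0 : s), diagonalAction ρ t x g) ∈ tailT K s t m k := by
    rw [mem_tailT] at hz ⊢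
    exact ⟨rfl, fun i hi => (congrArg (ρ (i.1 + 1) x) (hz.2 i hi)).trans (map_zero _)⟩
  have h₂ := tailT_mono k.le_succ (gradedProduct_mem_tailT (p := p) f hz)
  simpa [semidirectBracket] using add_mem h₁ h₂

/-- By irreducibility, an ideal meeting `m_k` modulo higher terms contains it modulo
higher terms. -/
theorem tailT_le_sup_of_ne_zero {S : Submodule K (s × ((i : Fin t) → m (i.1 + 1)))}
    (hS : IsBrIdeal K (semidirectBracket (diagonalAction ρ t) (gradedProduct p t)) S)
    {k : Fin t}
    (hirr : ∀ W : Submodule K (m (k.1 + 1)),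
      (∀ x : s, ∀ w ∈ W, ρ (k.1 + 1) x w ∈ W) → W = ⊥ ∨ W = ⊤)
    {z : s × ((i : Fin t) → m (i.1 + 1))} (hzS : z ∈ S ⊔ tailT K s t m (k.1 + 2))
    (hz : z ∈ tailT K s t m (k.1 + 1)) (hz0 : z.2 k ≠ 0) :
    tailT K s t m (k.1 + 1) ≤ S ⊔ tailT K s t m (k.1 + 2) := by
  let ι : m (k.1 + 1) →ₗ[K] s × ((i : Fin t) → m (i.1 + 1)) :=
    LinearMap.inr K s _ ∘ₗ LinearMap.single K (fun i : Fin t => m (i.1 + 1)) k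
  let W := (S ⊔ tailT K s t m (k.1 + 2)).comap ι
  have hW : ∀ w, w ∈ W ↔ ((0 : s), (Pi.single k w : (i : Fin t) → m (i.1 + 1))) ∈
      S ⊔ tailT K s t m (k.1 + 2) := fun w => Iff.rfl
  have hzW : z.2 k ∈ W := by
    rw [hW]
    have := sub_mem hzS (Submodule.mem_sup_right (S := S) (sub_single_mem_tailT hz))
    rwa [sub_sub_cancel] at this
  have hstable : ∀ x : s, ∀ w ∈ W, ρ (k.1 + 1) x w ∈ W := by
    intro x w hw
    rw [hW] at hw ⊢
    have := hS.sup (isBrIdeal_tailT (k.1 + 2)) (x, 0) _ hw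
    simpa [semidirectBracket, diagonalAction_single] using this
  rcases hirr W hstable with h | h
  · rw [h, Submodule.mem_bot] at hzW
    exact absurd hzW hz0
  · intro y hy
    have h₁ : y.2 k ∈ W := h ▸ Submodule.mem_top
    have h₂ := Submodule.mem_sup_right (S := S) (sub_single_mem_tailT hy)
    simpa using add_mem h₂ ((hW _).1 h₁)

/-- An ideal projecting onto `s` is everything. -/
theorem eq_top_of_fst_surjective
    (hL : IsLieBracket K _ (semidirectBracket (diagonalAction ρ t) (gradedProduct p t)))
    (hirr : ∀ i, 1 ≤ i → i ≤ t →
      (∃ (x : s) (u : m i), ρ i x u ≠ 0) ∧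
      (∀ W : Submodule K (m i), (∀ x : s, ∀ w ∈ W, ρ i x w ∈ W) → W = ⊥ ∨ W = ⊤))
    {S : Submodule K (s × ((i : Fin t) → m (i.1 + 1)))}
    (hS : IsBrIdeal K (semidirectBracket (diagonalAction ρ t) (gradedProduct p t)) S)
    (hsurj : ∀ x : s, ∃ f, (x, f) ∈ S) : S = ⊤ := by
  have hle : tailT K s t m 1 ≤ S := by
    refine tailT_le_of_forall_le_sup (by lia) fun l hl hlt => ?_
    obtain ⟨k, rfl⟩ := Nat.exists_eq_add_of_le' hl
    obtain ⟨⟨x, u, hxu⟩, hW⟩ := hirr (k + 1) hl hlt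
    obtain ⟨f, hf⟩ := hsurj x
    let k' : Fin t := ⟨k, hlt⟩
    have hsingle : ((0 : s), (Pi.single k' u : (i : Fin t) → m (i.1 + 1))) ∈
      tailT K s t m (k'.1 + 1) := single_mem_tailT (i := k') le_rfl u
    refine tailT_le_sup_of_ne_zero hS (k := k') hW
      (Submodule.mem_sup_left (hS.bracket_mem_left hL hf (0, Pi.single k' u)))
      (isBrIdeal_tailT _ _ _ hsingle) ?_
    have h0 : gradedProduct p t f (Pi.single k' u) k' = 0 :=
      (mem_tailT.1 (gradedProduct_mem_tailT (p := p) f hsingle)).2 k' (by lia)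
    simpa [semidirectBracket, h0, diagonalAction_apply] using hxu
  rw [eq_top_iff]
  rintro ⟨x, g⟩ -
  obtain ⟨f, hf⟩ := hsurj x
  have : ((0 : s), g - f) ∈ S := hle (tailT_one_iff.2 rfl)
  simpa using add_mem hf this

/-- An ideal contained in `m₁ ⊕ ⋯ ⊕ m_t` is one of the tails. -/
theorem exists_eq_tailT_of_le
    (hirr : ∀ i, 1 ≤ i → i ≤ t →
      ∀ W : Submodule K (m i), (∀ x : s, ∀ w ∈ W, ρ i x w ∈ W) → W = ⊥ ∨ W = ⊤)
    (hnonzero : ∀ j, 1 ≤ j → j + 1 ≤ t → p 1 j (j + 1) ≠ 0)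
    {S : Submodule K (s × ((i : Fin t) → m (i.1 + 1)))}
    (hS : IsBrIdeal K (semidirectBracket (diagonalAction ρ t) (gradedProduct p t)) S)
    (hle : S ≤ tailT K s t m 1) : ∃ k, 1 ≤ k ∧ k ≤ t + 1 ∧ S = tailT K s t m k := by
  classical
  let k := Nat.findGreatest (fun k => S ≤ tailT K s t m k) (t + 1)
  have hk1 : 1 ≤ k := Nat.le_findGreatest (by lia) hle
  have hkS : S ≤ tailT K s t m k :=
    Nat.findGreatest_spec (P := fun k => S ≤ tailT K s t m k) (by lia : 1 ≤ t + 1) hle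
  have hkt : k ≤ t + 1 := Nat.findGreatest_le _
  refine ⟨k, hk1, hkt, le_antisymm hkS (tailT_le_of_forall_le_sup hkt fun l hl => ?_)⟩
  induction l, hl using Nat.le_induction with
  | base =>
    intro hkt'
    have hnot : ¬ S ≤ tailT K s t m (k + 1) :=
      Nat.findGreatest_is_greatest (P := fun k => S ≤ tailT K s t m k) (Nat.lt_succ_self k)
        (by lia)
    obtain ⟨z, hzS, hz⟩ := SetLike.not_le_iff_exists.1 hnot
    have hzk := hkS hzS
    clear_value k
    obtain ⟨k, rfl⟩ := Nat.exists_eq_add_of_le' hk1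
    refine tailT_le_sup_of_ne_zero hS (k := ⟨k, hkt'⟩) (hirr _ hk1 hkt')
      (Submodule.mem_sup_left hzS) hzk fun h0 => hz ?_
    have := sub_single_mem_tailT (k := ⟨k, hkt'⟩) hzk
    rwa [h0, Pi.single_zero, Prod.mk_zero_zero, sub_zero] at this
  | succ l hl ih =>
    intro hlt
    have hl1 : 1 ≤ l := hk1.trans hl
    have hne := hnonzero l hl1 hlt
    obtain ⟨u, v, huv⟩ : ∃ u v, p 1 l (l + 1) u v ≠ 0 := by
      by_contra! h
      exact hne (LinearMap.ext₂ h)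
    have ihl := ih (by lia)
    obtain ⟨l, rfl⟩ := Nat.exists_eq_add_of_le' hl1
    let i₀ : Fin t := ⟨0, by lia⟩
    let i₁ : Fin t := ⟨l, by lia⟩
    let i₂ : Fin t := ⟨l + 1, hlt⟩
    have hv : ((0 : s), (Pi.single i₁ v : (i : Fin t) → m (i.1 + 1))) ∈
        tailT K s t m (l + 1) := single_mem_tailT (i := i₁) le_rfl v
    refine tailT_le_sup_of_ne_zero hS (k := i₂) (hirr _ (by lia) hlt)
      (z := semidirectBracket (diagonalAction ρ t) (gradedProduct p t)
        (0, Pi.single i₀ u) (0, Pi.single i₁ v)) ?_ (bracket_mem_tailT_succ _ hv) ?_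
    · obtain ⟨a, ha, b, hb, hab⟩ := Submodule.mem_sup.1 (ihl hv)
      rw [← hab, semidirectBracket_add_right]
      exact Submodule.add_mem_sup (hS _ a ha) (bracket_mem_tailT_succ _ hb)
    · have : gradedProduct p t (Pi.single i₀ u) (Pi.single i₁ v) i₂ = p 1 (l + 1) (l + 2) u v := by
        rw [gradedProduct_single_single, skewExtension_of_le (by simp [i₀, i₁, i₂]; lia)
          (by simp [i₀, i₁])]
      simpa [semidirectBracket, this] using huv

end Ideals

/-- **Chain construction.** Given a simple Lie algebra `s`, irreducible `s`-modules
`m₁, …, m_t` with `ρ₁` faithful, and `s`-equivariant maps `p_{ijk} : m_i ⊗ m_j → m_k`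
(skew for `i = j`, nonzero for `i = 1`, `k = j+1`) satisfying the Jacobi-type identity,
the space `g = s ⊕ m₁ ⊕ ⋯ ⊕ m_t` carries a Lie bracket whose lattice of ideals is the
`(t+2)`-element chain `0 < m_t < m_{t-1} ⊕ m_t < ⋯ < m₁ ⊕ ⋯ ⊕ m_t < g`. -/
theorem chain_construction
    (K : Type*) [Field K] [CharZero K]
    (s : Type*) [LieRing s] [LieAlgebra K s] [FiniteDimensional K s]
    (hsimple : LieAlgebra.IsSimple K s)
    (t : ℕ) (ht : 1 ≤ t)
    (m : ℕ → Type*) [∀ i, AddCommGroup (m i)] [∀ i, Module K (m i)]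
    [∀ i, FiniteDimensional K (m i)]
    (ρ : (i : ℕ) → s →ₗ[K] m i →ₗ[K] m i)
    (hρ : ∀ i (x y : s), ρ i ⁅x, y⁆ = ρ i x ∘ₗ ρ i y - ρ i y ∘ₗ ρ i x)
    (hfaithful : ∀ x : s, ρ 1 x = 0 → x = 0)
    (hirr : ∀ i, 1 ≤ i → i ≤ t →
      (∃ (x : s) (u : m i), ρ i x u ≠ 0) ∧
      (∀ W : Submodule K (m i), (∀ x : s, ∀ w ∈ W, ρ i x w ∈ W) → W = ⊥ ∨ W = ⊤))
    (p : (i j k : ℕ) → m i →ₗ[K] m j →ₗ[K] m k)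
    (hequiv : ∀ i j k, 1 ≤ i → i ≤ j → j ≤ k → k ≤ t → i + j ≤ k →
      ∀ (x : s) (u : m i) (v : m j),
        p i j k (ρ i x u) v + p i j k u (ρ j x v) = ρ k x (p i j k u v))
    (hskew : ∀ i k, 1 ≤ i → i + i ≤ k → k ≤ t →
      ∀ u v : m i, p i i k u v = - p i i k v u)
    (hnonzero : ∀ j, 1 ≤ j → j + 1 ≤ t → p 1 j (j + 1) ≠ 0)
    (hjacobi : ∀ i j k r, 1 ≤ i → i ≤ j → j ≤ k → i + j + k ≤ t → r ≤ t →
      ∀ (u : m i) (v : m j) (w : m k),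
        (∑ l ∈ Finset.Icc (j + k) (r - i), p i l r u (p j k l v w))
        - (∑ l ∈ Finset.Icc (i + k) (r - j), p j l r v (p i k l u w))
        + (∑ l ∈ Finset.Icc (i + j) (r - k),
            if k ≤ l then p k l r w (p i j l u v) else - p l k r (p i j l u v) w) = 0) :
    ∃ br : (s × ((i : Fin t) → m (i.1 + 1))) → (s × ((i : Fin t) → m (i.1 + 1))) →
        (s × ((i : Fin t) → m (i.1 + 1))),
      IsLieBracket K _ br ∧
      (∀ x y : s, br (x, 0) (y, 0) = (⁅x, y⁆, 0)) ∧
      (∀ (x : s) (f : (i : Fin t) → m (i.1 + 1)),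
        br (x, 0) (0, f) = (0, fun i => ρ (i.1 + 1) x (f i))) ∧
      (∀ i j : Fin t, i ≤ j → ∀ (u : m (i.1 + 1)) (v : m (j.1 + 1)),
        br (0, Pi.single i u) (0, Pi.single j v) =
          (0, fun k : Fin t =>
            if i.1 + j.1 + 1 ≤ k.1 then p (i.1 + 1) (j.1 + 1) (k.1 + 1) u v else 0)) ∧
      (∀ S : Submodule K (s × ((i : Fin t) → m (i.1 + 1))), IsBrIdeal K br S →
        S = ⊤ ∨ ∃ k, 1 ≤ k ∧ k ≤ t + 1 ∧ S = tailT K s t m k) ∧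
      (∀ k, 1 ≤ k → k ≤ t + 1 → IsBrIdeal K br (tailT K s t m k)) ∧
      (∀ k, 1 ≤ k → k ≤ t → tailT K s t m (k + 1) < tailT K s t m k) ∧
      (tailT K s t m 1 < ⊤) ∧ (tailT K s t m (t + 1) = ⊥) := by
  have hL : IsLieBracket K _ (semidirectBracket (diagonalAction ρ t) (gradedProduct p t)) := by
    refine isLieBracket_semidirectBracket _ _ (fun x y f => ?_) (gradedProduct_skew hskew)
      (diagonalAction_gradedProduct hequiv)
      (gradedProduct_jacobi fun i j k r hi hj hk hr =>
        gradedJacobiator_skewExtension_eq_zero hskew hjacobi hi hj hk hr)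
    ext i
    simp [diagonalAction_apply, hρ]
  have hnontrivial : Nontrivial s := by
    by_contra h
    rw [not_nontrivial_iff_subsingleton] at h
    exact hsimple.non_abelian ⟨fun x y => Subsingleton.elim _ _⟩
  refine ⟨semidirectBracket (diagonalAction ρ t) (gradedProduct p t), hL, fun x y => ?_,
    fun x f => ?_, fun i j hij u v => ?_, fun S hS => ?_, fun k _ _ => isBrIdeal_tailT k,
    fun k hk hkt => ?_, ?_, tailT_succ_eq_bot⟩
  · simp [semidirectBracket]
  · ext <;> simp [semidirectBracket, diagonalAction_apply]
  · ext k
    · simp [semidirectBracket]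
    · simp only [semidirectBracket, map_zero, LinearMap.zero_apply, sub_zero, zero_add,
        gradedProduct_single_single]
      split_ifs with h
      · rw [skewExtension_of_le (by lia) (by simpa using hij)]
      · rw [skewExtension_of_lt (by lia)]
        simp
  · rcases hS.fst_eq_zero_or_surjective with h | h
    · exact Or.inr (exists_eq_tailT_of_le (fun i hi hit => (hirr i hi hit).2) hnonzero hS
        fun z hz => tailT_one_iff.2 (h z hz))
    · exact Or.inl (eq_top_of_fst_surjective hL hirr hS h)
  · refine lt_of_le_of_ne (tailT_mono k.le_succ) fun h => ?_
    obtain ⟨⟨x, u, hxu⟩, -⟩ := hirr k hk hkt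
    obtain ⟨k, rfl⟩ := Nat.exists_eq_add_of_le' hk
    have hu := single_mem_tailT (K := K) (s := s) (m := m) (i := (⟨k, hkt⟩ : Fin t)) le_rfl u
    have h0 : u = 0 := by
      simpa using (mem_tailT.1 (h.ge hu)).2 ⟨k, hkt⟩ (by simp)
    exact hxu (by rw [h0, map_zero])
  · refine lt_top_iff_ne_top.2 fun h => ?_
    obtain ⟨x, hx⟩ := exists_ne (0 : s)
    exact hx (tailT_one_iff.1 (h ▸ Submodule.mem_top : (x, 0) ∈ tailT K s t m 1))
end
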